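/- The limit inferior, as n → ∞, of a₀(n)/n⁴ is at least 1/4. -/

import Mathlib

/-- The grid `A_n = {(x,y) ∈ ℤ² : 1 ≤ x, y ≤ n}`. -/
def gridSet (n : ℕ) : Set (ℤ × ℤ) :=
  {p | 1 ≤ p.1 ∧ p.1 ≤ (n : ℤ) ∧ 1 ≤ p.2 ∧ p.2 ≤ (n : ℤ)}

/-- The embedding of an integer lattice point into the real plane. -/
def toR2 (p : ℤ × ℤ) : ℝ × ℝ := ((p.1 : ℝ), (p.2 : ℝ))

/-- Squared Euclidean distance between two lattice points, as a natural number. -/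
def sqLen (p q : ℤ × ℤ) : ℕ := (q.1 - p.1).natAbs ^ 2 + (q.2 - p.2).natAbs ^ 2

/-- `f : ZMod (n²) → ℤ × ℤ` is a simple closed grid polygon on `A_n`:
it is a bijection onto `A_n`, and any two distinct (closed) edges of the closed
polygonal curve `f 0, f 1, …, f (n²-1), f 0` meet only in common endpoints. -/
structure IsSimpleClosedGridPolygon (n : ℕ) (f : ZMod (n ^ 2) → ℤ × ℤ) : Prop where
  inj : Function.Injective f
  range_eq : Set.range f = gridSet n
  simple : ∀ i j : ZMod (n ^ 2), i ≠ j →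
    segment ℝ (toR2 (f i)) (toR2 (f (i + 1))) ∩
        segment ℝ (toR2 (f j)) (toR2 (f (j + 1))) ⊆
      ({toR2 (f i), toR2 (f (i + 1))} : Set (ℝ × ℝ)) ∩
        ({toR2 (f j), toR2 (f (j + 1))} : Set (ℝ × ℝ))

/-- The weight `s(f)`: sum of the squared Euclidean side lengths. -/
def polyWeight (n : ℕ) (f : ZMod (n ^ 2) → ℤ × ℤ) : ℕ :=
  ∑ i ∈ Finset.range (n ^ 2), sqLen (f (i : ZMod (n ^ 2))) (f ((i : ZMod (n ^ 2)) + 1))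

/-- `a(n)`: the maximal weight of a simple closed grid polygon on `A_n`. -/
noncomputable def polyA (n : ℕ) : ℕ :=
  sSup {w : ℕ | ∃ f, IsSimpleClosedGridPolygon n f ∧ polyWeight n f = w}

/-- A grid polygon is proper if no three consecutive vertices are collinear. -/
def IsProper (n : ℕ) (f : ZMod (n ^ 2) → ℤ × ℤ) : Prop :=
  ∀ i : ZMod (n ^ 2),
    ¬ Collinear ℝ ({toR2 (f i), toR2 (f (i + 1)), toR2 (f (i + 2))} : Set (ℝ × ℝ))

/-- `a₀(n)`: the maximal weight of a proper simple closed grid polygon on `A_n`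
(the supremum in `ℕ`, equal to `0` if no proper polygon exists). -/
noncomputable def polyA0 (n : ℕ) : ℕ :=
  sSup {w : ℕ | ∃ f, IsSimpleClosedGridPolygon n f ∧ IsProper n f ∧ polyWeight n f = w}

/-- The successor map on the `2M × 2M` block `1 ≤ x, y ≤ 2M`. -/
def blockNext (M x y : ℤ) : ℤ × ℤ :=
  if y = 1 then
    if x % 2 = 1 then (x + 1, 1) else if x = 2 * M then (x, 2) else (x / 2, 2)
  else if y = 2 then
    if x < M then (2 * x + 1, 1) else (x - M + 1, 3)
  else if y = 2 * M then
    if x % 2 = 1 then (x + 1, y) else if x = 2 * M then (x, y + 1) else (M + 1 + x / 2, y - 1)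
  else if y % 2 = 1 then
    if x = 1 then (1, y + 1)
    else if x ≤ M + 1 then (x + M - 2, y - 1)
    else if y = 2 * M - 1 then (2 * x - 2 * M - 1, y + 1)
    else if x = 2 * M then (x, y + 1) else (x - M, y + 1)
  else if x < M then (x + M + 1, y - 1) else (x - M + 1, y + 1)

/-- The successor map on the `w` columns `1 - w ≤ x ≤ 0` to the left of the block. -/
def ladderNext (w x y : ℤ) : ℤ × ℤ :=
  if y = 1 then if x = 1 - w then (x + 1, 1) else (x, 2)
  else if y = 2 then if x = 1 - w then (x, 1) else (x + 1, 1)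
  else if y % 2 = 0 then (x, y - 1)
  else if x < 0 then (x + 1, y + 1) else (1 - w, y - 1)

/-- The successor map on the top rows when the frame has width `2`. -/
def frameNextTwo (M x y : ℤ) : ℤ × ℤ :=
  if y = 2 * M + 2 then
    if x = 0 then (-1, y) else if x = -1 then (-1, y - 1)
    else if x % 2 = 0 then (x - 1, y) else (x - 1, y - 1)
  else if y = 2 * M + 1 then
    if x = 0 then (0, y + 1) else if x = -1 then (0, y - 1)
    else if x % 2 = 0 then (x - 1, y) else (x + 1, y + 1)
  else if y = 2 * M then
    if x = 0 then (-1, y) else (-1, y - 1)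
  else if x = 0 then (-1, y - 1) else (0, y)

/-- The successor map on the top rows when the frame has width `3`. -/
def frameNextThree (M x y : ℤ) : ℤ × ℤ :=
  if y = 2 * M + 3 then
    if x = -1 then (0, y - 1) else if x = -2 then (-1, y - 1)
    else if x % 2 = 0 then (x - 1, y) else (x, y - 1)
  else if y = 2 * M + 2 then
    if x = 3 then (2, y + 1) else if x = 2 then (1, y - 1) else if x = 1 then (0, y + 1)
    else if x = 0 then (-2, y + 1) else if x = -1 then (-2, y) else if x = -2 then (-2, y - 1)
    else if x % 2 = 0 then (x, y + 1) else (x - 1, y - 1)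
  else if y = 2 * M + 1 then
    if x = 2 then (-1, y - 1) else if x = 1 then (2, y) else if x = 0 then (-2, y - 1)
    else if x = -1 then (2, y + 1) else if x = -2 then (-1, y)
    else if x % 2 = 0 then (x - 1, y) else (x + 1, y + 1)
  else if y = 2 * M then
    if x = 0 then (0, y - 1) else if x = -1 then (0, y + 1) else (-2, y - 1)
  else if x = 0 then (-2, y - 1) else if x = -1 then (0, y + 1) else (-1, y)

/-- The successor map of the polygon. -/
def polyNext (w M : ℤ) (p : ℤ × ℤ) : ℤ × ℤ :=
  if p.2 ≤ 2 * M ∧ 1 ≤ p.1 then blockNext M p.1 p.2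
  else if p.2 ≤ 2 * M - 2 then ladderNext w p.1 p.2
  else if w = 2 then frameNextTwo M p.1 p.2
  else frameNextThree M p.1 p.2

/-- The range of the polygon: a square of side `2M + w`, with `x`-coordinates shifted by `w`. -/
def InRange (w M : ℤ) (p : ℤ × ℤ) : Prop :=
  1 - w ≤ p.1 ∧ p.1 ≤ 2 * M ∧ 1 ≤ p.2 ∧ p.2 ≤ 2 * M + w

/-- In the strip between the rows `y` and `y + 1`, an edge starting at abscissa `a` below ends at an
abscissa between `barrier y a` and `barrier y (a + 1)` above. -/
def barrier (w M y a : ℤ) : ℤ :=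
  if y = 1 then if a ≤ 0 then a - 1 else if a ≤ 2 * M then a / 2 else 2 * M
  else if y ≤ 2 * M - 2 then
    if a ≤ 0 then if y % 2 = 1 ∨ a ≤ 1 - w then a else 0
    else if 2 * M < a then 2 * M
    else if y % 2 = 0 then max 1 (a - M + 1) else max 1 (a - M - 1)
  else if y = 2 * M - 1 then
    if a ≤ 0 then if a ≤ 1 - w then a else 0 else max 1 (2 * (a - M - 1))
  else if w = 2 then
    if y = 2 * M then if a ≤ 0 then a - 1 else if a ≤ 2 * M then 0 else a else a
  else if y = 2 * M then
    if a ≤ -2 then a else if a = -1 then 0 else if a ≤ 2 * M then 2 else a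
  else if y = 2 * M + 1 then if a ≤ -1 then a else max 2 a
  else if 1 ≤ a then a - 1 else -2

theorem barrier_mono {w M : ℤ} (hM : 3 ≤ M) (y a : ℤ) :
    barrier w M y a ≤ barrier w M y (a + 1) := by
  unfold barrier
  split_ifs <;> omega

/-- The two lattice points can be joined by an edge compatible with the barriers `g`. -/
def IsEdge (g : ℤ → ℤ → ℤ) (p q : ℤ × ℤ) : Prop :=
  (q.2 = p.2 ∧ (q.1 = p.1 + 1 ∨ q.1 = p.1 - 1)) ∨
  (q.2 = p.2 + 1 ∧ g p.2 p.1 ≤ q.1 ∧ q.1 ≤ g p.2 (p.1 + 1)) ∨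
  (p.2 = q.2 + 1 ∧ g q.2 q.1 ≤ p.1 ∧ p.1 ≤ g q.2 (q.1 + 1))

theorem blockNext_edge {w M x y : ℤ} (hM : 3 ≤ M) (hx : 1 ≤ x)
    (hx' : x ≤ 2 * M) (hy' : y ≤ 2 * M) :
    IsEdge (barrier w M) (x, y) (blockNext M x y) := by
  unfold blockNext
  split_ifs <;> first
    | refine Or.inl ⟨?_, ?_⟩ <;> dsimp only <;> omega
    | refine Or.inr (Or.inl ⟨?_, ?_, ?_⟩) <;> simp (disch := omega) only
      [barrier, ↓if_pos, ↓if_neg] <;>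
      (try split_ifs) <;> omega
    | refine Or.inr (Or.inr ⟨?_, ?_, ?_⟩) <;> simp (disch := omega) only
      [barrier, ↓if_pos, ↓if_neg] <;>
      (try split_ifs) <;> omega

theorem ladderNext_edge {w M x y : ℤ} (hw : w = 2 ∨ w = 3) (hM : 3 ≤ M) (hx : 1 - w ≤ x)
    (hx' : x ≤ 0) (hy : 1 ≤ y) (hy' : y ≤ 2 * M - 2) :
    IsEdge (barrier w M) (x, y) (ladderNext w x y) := by
  unfold ladderNext
  split_ifs <;> first
    | refine Or.inl ⟨?_, ?_⟩ <;> dsimp only <;> omega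
    | refine Or.inr (Or.inl ⟨?_, ?_, ?_⟩) <;> simp (disch := omega) only
      [barrier, ↓if_pos, ↓if_neg] <;>
      (try split_ifs) <;> omega
    | refine Or.inr (Or.inr ⟨?_, ?_, ?_⟩) <;> simp (disch := omega) only
      [barrier, ↓if_pos, ↓if_neg] <;>
      (try split_ifs) <;> omega

theorem frameNextTwo_edge {M x y : ℤ} (hM : 3 ≤ M) (hx : -1 ≤ x)
    (hy : 2 * M - 1 ≤ y) (hy' : y ≤ 2 * M + 2) (h : 2 * M < y ∨ x ≤ 0) :
    IsEdge (barrier 2 M) (x, y) (frameNextTwo M x y) := by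
  unfold frameNextTwo
  split_ifs <;> first
    | refine Or.inl ⟨?_, ?_⟩ <;> dsimp only <;> omega
    | refine Or.inr (Or.inl ⟨?_, ?_, ?_⟩) <;> simp (disch := omega) only
      [barrier, ↓if_pos, ↓if_neg] <;>
      omega
    | refine Or.inr (Or.inr ⟨?_, ?_, ?_⟩) <;> simp (disch := omega) only
      [barrier, ↓if_pos, ↓if_neg] <;>
      omega

set_option maxHeartbeats 1000000 in
theorem frameNextThree_edge {M x y : ℤ} (hM : 3 ≤ M) (hx : -2 ≤ x) (hx' : x ≤ 2 * M)
    (hy : 2 * M - 1 ≤ y) (hy' : y ≤ 2 * M + 3) (h : 2 * M < y ∨ x ≤ 0) :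
    IsEdge (barrier 3 M) (x, y) (frameNextThree M x y) := by
  unfold frameNextThree
  split_ifs <;> first
    | refine Or.inl ⟨?_, ?_⟩ <;> dsimp only <;> omega
    | refine Or.inr (Or.inl ⟨?_, ?_, ?_⟩) <;> simp (disch := omega) only
      [barrier, ↓if_pos, ↓if_neg] <;>
      omega
    | refine Or.inr (Or.inr ⟨?_, ?_, ?_⟩) <;> simp (disch := omega) only
      [barrier, ↓if_pos, ↓if_neg] <;>
      omega

theorem polyNext_mk (w M x y : ℤ) : polyNext w M (x, y) =
    if y ≤ 2 * M ∧ 1 ≤ x then blockNext M x y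
    else if y ≤ 2 * M - 2 then ladderNext w x y
    else if w = 2 then frameNextTwo M x y
    else frameNextThree M x y := rfl

theorem polyNext_edge {w M : ℤ} (hw : w = 2 ∨ w = 3) (hM : 3 ≤ M) {p : ℤ × ℤ}
    (hp : InRange w M p) : IsEdge (barrier w M) p (polyNext w M p) := by
  obtain ⟨x, y⟩ := p
  obtain ⟨h1, h2, h3, h4⟩ := hp
  dsimp only at h1 h2 h3 h4
  simp only [polyNext]
  split_ifs with c1 c2 c3
  · exact blockNext_edge hM c1.2 h2 c1.1
  · exact ladderNext_edge hw hM h1 (by omega) h3 c2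
  · subst c3
    exact frameNextTwo_edge hM h1 (by omega) h4 (by omega)
  · obtain rfl : w = 3 := by omega
    exact frameNextThree_edge hM h1 h2 (by omega) h4 (by omega)

theorem blockNext_inRange {w M x y : ℤ} (hw : w = 2 ∨ w = 3) (hM : 3 ≤ M)
    (hx : 1 ≤ x) (hx' : x ≤ 2 * M) (hy : 1 ≤ y) (hy' : y ≤ 2 * M) :
    InRange w M (blockNext M x y) := by
  unfold blockNext InRange
  split_ifs <;> dsimp only <;> omega

theorem ladderNext_inRange {w M x y : ℤ} (hM : 3 ≤ M) (hx : 1 - w ≤ x)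
    (hx' : x ≤ 0) (hy : 1 ≤ y) (hy' : y ≤ 2 * M - 2) : InRange w M (ladderNext w x y) := by
  unfold ladderNext InRange
  split_ifs <;> dsimp only <;> omega

theorem frameNextTwo_inRange {M x y : ℤ} (hM : 3 ≤ M) (hx : -1 ≤ x) (hx' : x ≤ 2 * M)
    (hy : 2 * M - 1 ≤ y) (hy' : y ≤ 2 * M + 2) : InRange 2 M (frameNextTwo M x y) := by
  unfold frameNextTwo InRange
  split_ifs <;> dsimp only <;> omega

set_option maxHeartbeats 1000000 in
theorem frameNextThree_inRange {M x y : ℤ} (hM : 3 ≤ M) (hx : -2 ≤ x) (hx' : x ≤ 2 * M)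
    (hy : 2 * M - 1 ≤ y) (hy' : y ≤ 2 * M + 3) : InRange 3 M (frameNextThree M x y) := by
  unfold frameNextThree InRange
  split_ifs <;> dsimp only <;> omega

theorem polyNext_inRange {w M : ℤ} (hw : w = 2 ∨ w = 3) (hM : 3 ≤ M) {p : ℤ × ℤ}
    (hp : InRange w M p) : InRange w M (polyNext w M p) := by
  obtain ⟨x, y⟩ := p
  obtain ⟨h1, h2, h3, h4⟩ := hp
  dsimp only at h1 h2 h3 h4
  simp only [polyNext]
  split_ifs with c1 c2 c3
  · exact blockNext_inRange hw hM c1.2 h2 h3 c1.1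
  · exact ladderNext_inRange hM h1 (by omega) h3 c2
  · subst c3
    exact frameNextTwo_inRange hM h1 h2 (by omega) h4
  · obtain rfl : w = 3 := by omega
    exact frameNextThree_inRange hM h1 h2 (by omega) h4

theorem polyNext_long {w M x y : ℤ} (hx : 2 ≤ x) (hx' : x ≤ 2 * M - 1) (hy : 3 ≤ y)
    (hy' : y ≤ 2 * M - 2) :
    M - 2 ≤ (polyNext w M (x, y)).1 - x ∨ M - 2 ≤ x - (polyNext w M (x, y)).1 := by
  rw [polyNext, if_pos (by dsimp only; omega)]
  unfold blockNext
  split_ifs <;> dsimp only <;> omega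

/-- The three consecutive vertices `p`, `q`, `r` are neither on one row nor in arithmetic
progression. -/
def IsTurn (p q r : ℤ × ℤ) : Prop :=
  ¬ (q.2 = p.2 ∧ r.2 = q.2) ∧ (q.2 - p.2 = r.2 - q.2 → q.1 - p.1 ≠ r.1 - q.1)

set_option maxHeartbeats 1000000 in
theorem ladderNext_turn {w M x y : ℤ} (hw : w = 2 ∨ w = 3) (hM : 3 ≤ M) (hx : 1 - w ≤ x)
    (hx' : x ≤ 0) (hy : 1 ≤ y) (hy' : y ≤ 2 * M - 2) :
    IsTurn (x, y) (ladderNext w x y) (polyNext w M (ladderNext w x y)) := by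
  unfold ladderNext
  split_ifs <;> simp (disch := omega) only [polyNext_mk, blockNext, ↓if_pos, ↓if_neg] <;>
    unfold ladderNext IsTurn <;> (try split_ifs) <;> dsimp only <;> omega

set_option maxHeartbeats 1000000 in
theorem blockNext_turn {w M x y : ℤ} (hM : 3 ≤ M) (hx : 1 ≤ x) (hx' : x ≤ 2 * M) (hy : 1 ≤ y)
    (hy' : y ≤ 2 * M) :
    IsTurn (x, y) (blockNext M x y) (polyNext w M (blockNext M x y)) := by
  unfold blockNext
  split_ifs <;> simp (disch := omega) only [polyNext_mk, blockNext, frameNextTwo, frameNextThree,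
    ↓if_pos, ↓if_neg] <;> unfold IsTurn <;> (try split_ifs) <;> dsimp only <;> omega

set_option maxHeartbeats 1000000 in
theorem frameNextTwo_turn {M x y : ℤ} (hM : 3 ≤ M) (hx : -1 ≤ x)
    (hy : 2 * M - 1 ≤ y) (hy' : y ≤ 2 * M + 2) :
    IsTurn (x, y) (frameNextTwo M x y) (polyNext 2 M (frameNextTwo M x y)) := by
  unfold frameNextTwo
  split_ifs <;> simp (disch := omega) only [polyNext_mk, ladderNext, frameNextTwo,
    ↓if_pos, ↓if_neg] <;> unfold IsTurn <;> (try split_ifs) <;> dsimp only <;> omega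

set_option maxHeartbeats 1000000 in
theorem frameNextThree_turn {M x y : ℤ} (hM : 3 ≤ M) (hx : -2 ≤ x)
    (hy : 2 * M - 1 ≤ y) (hy' : y ≤ 2 * M + 3) :
    IsTurn (x, y) (frameNextThree M x y) (polyNext 3 M (frameNextThree M x y)) := by
  unfold frameNextThree
  split_ifs <;> simp (disch := omega) only [polyNext_mk, ladderNext, frameNextThree,
    ↓if_pos, ↓if_neg] <;> unfold IsTurn <;> (try split_ifs) <;> dsimp only <;> omega

theorem polyNext_turn {w M : ℤ} (hw : w = 2 ∨ w = 3) (hM : 3 ≤ M) {p : ℤ × ℤ}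
    (hp : InRange w M p) : IsTurn p (polyNext w M p) (polyNext w M (polyNext w M p)) := by
  obtain ⟨x, y⟩ := p
  obtain ⟨h1, h2, h3, h4⟩ := hp
  dsimp only at h1 h2 h3 h4
  by_cases c1 : y ≤ 2 * M ∧ 1 ≤ x
  · rw [show polyNext w M (x, y) = blockNext M x y from if_pos c1]
    exact blockNext_turn hM c1.2 h2 h3 c1.1
  by_cases c2 : y ≤ 2 * M - 2
  · rw [show polyNext w M (x, y) = ladderNext w x y from (if_neg c1).trans (if_pos c2)]
    exact ladderNext_turn hw hM h1 (by omega) h3 c2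
  obtain rfl | rfl := hw
  · rw [show polyNext 2 M (x, y) = frameNextTwo M x y from
      (if_neg c1).trans ((if_neg c2).trans (if_pos rfl))]
    exact frameNextTwo_turn hM h1 (by omega) h4
  · rw [show polyNext 3 M (x, y) = frameNextThree M x y from
      (if_neg c1).trans ((if_neg c2).trans (if_neg (by norm_num)))]
    exact frameNextThree_turn hM h1 (by omega) h4

/-- The vertex `p` lies on the orbit of `(1, 1)`. -/
def Reach (w M : ℤ) (p : ℤ × ℤ) : Prop := ∃ i : ℕ, (polyNext w M)^[i] (1, 1) = p

theorem Reach.step {w M : ℤ} {p q : ℤ × ℤ} (h : Reach w M p)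
    (e : polyNext w M p = q := by
      simp (disch := omega) only [polyNext_mk, blockNext, ladderNext, frameNextTwo, frameNextThree,
        ↓if_pos, ↓if_neg, if_true, if_false, Prod.mk.injEq, and_true, true_and] <;> omega) :
    Reach w M q := by
  obtain ⟨i, hi⟩ := h
  exact ⟨i + 1, by rw [Function.iterate_succ_apply', hi, e]⟩

theorem reach_row_one_odd {w M : ℤ} (j : ℕ) (hj : j + 1 ≤ M) : Reach w M (2 * j + 1, 1) := by
  induction j with
  | zero => exact ⟨0, rfl⟩
  | succ j ih =>
    push_cast at hj ⊢
    have h1 : Reach w M (2 * j + 2, 1) := (ih (by omega)).step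
    have h2 : Reach w M (j + 1, 2) := h1.step
    exact h2.step

theorem reach_row_one {w M x : ℤ} (hx : 1 ≤ x) (hx' : x ≤ 2 * M) : Reach w M (x, 1) := by
  have h := reach_row_one_odd (w := w) (M := M) ((x - 1) / 2).toNat (by omega)
  have e : (((x - 1) / 2).toNat : ℤ) = (x - 1) / 2 := Int.toNat_of_nonneg (by omega)
  rw [e] at h
  by_cases hx2 : x % 2 = 1
  · convert h using 2
    omega
  · exact h.step

theorem reach_even_strip {w M y : ℤ} (hy : 2 ≤ y) (hy' : y ≤ 2 * M - 2) (hy2 : y % 2 = 0)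
    (h : Reach w M (2 * M, y)) (k : ℕ) (hk : k ≤ M) : Reach w M (2 * M - k, y) := by
  induction k with
  | zero => simpa using h
  | succ k ih =>
    push_cast at hk ⊢
    have h1 : Reach w M (M + 1 - k, y + 1) := by
      by_cases c : y = 2 <;> exact (ih (by omega)).step
    exact h1.step

theorem reach_odd_strip {w M y : ℤ} (hM : 3 ≤ M) (hy : 3 ≤ y) (hy' : y ≤ 2 * M - 3)
    (hy2 : y % 2 = 1) (h : Reach w M (1, y + 1)) (k : ℕ) (hk : k + 2 ≤ M) :
    Reach w M (1 + k, y + 1) := by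
  induction k with
  | zero => simpa using h
  | succ k ih =>
    push_cast at hk ⊢
    have h1 : Reach w M (2 + k + M, y) := (ih (by omega)).step
    exact h1.step

theorem reach_right_column {w M : ℤ} (hM : 3 ≤ M) (i : ℕ) (hi : i + 2 ≤ M) :
    Reach w M (2 * M, 2 * i + 2) := by
  induction i with
  | zero => exact (reach_row_one (x := 2 * M) (by omega) le_rfl).step
  | succ i ih =>
    push_cast at hi ⊢
    have h1 := reach_even_strip (by omega) (by omega) (by omega) (ih (by omega)) M.toNat (by omega)
    have e : (M.toNat : ℤ) = M := Int.toNat_of_nonneg (by omega)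
    rw [e] at h1
    have h2 : Reach w M (1, 2 * i + 2 + 1) := by
      by_cases c : i = 0 <;> exact h1.step
    have h3 : Reach w M (1, 2 * i + 3 + 1) := h2.step
    have h4 := reach_odd_strip hM (by omega) (by omega) (by omega) h3 (M - 2).toNat (by omega)
    have e' : ((M - 2).toNat : ℤ) = M - 2 := Int.toNat_of_nonneg (by omega)
    rw [e'] at h4
    have h5 : Reach w M (2 * M, 2 * i + 3) := h4.step
    exact h5.step

theorem reach_even_row_right {w M x y : ℤ} (hM : 3 ≤ M) (hx : M ≤ x) (hx' : x ≤ 2 * M)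
    (hy : 2 ≤ y) (hy' : y ≤ 2 * M - 2) (hy2 : y % 2 = 0) : Reach w M (x, y) := by
  have h := reach_right_column (w := w) hM ((y - 2) / 2).toNat (by omega)
  have e : 2 * (((y - 2) / 2).toNat : ℤ) + 2 = y := by omega
  rw [e] at h
  have h1 := reach_even_strip hy hy' hy2 h (2 * M - x).toNat (by omega)
  have e' : 2 * M - ((2 * M - x).toNat : ℤ) = x := by omega
  rwa [e'] at h1

theorem reach_odd_row_left {w M x y : ℤ} (hM : 3 ≤ M) (hx : 1 ≤ x) (hx' : x ≤ M + 1)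
    (hy : 3 ≤ y) (hy' : y ≤ 2 * M - 1) (hy2 : y % 2 = 1) : Reach w M (x, y) := by
  have h := reach_even_row_right (w := w) (x := x + M - 1) (y := y - 1) hM (by omega) (by omega)
    (by omega) (by omega) (by omega)
  by_cases c : y = 3 <;> exact h.step

theorem reach_even_row_left {w M x y : ℤ} (hM : 3 ≤ M) (hx : 1 ≤ x) (hx' : x ≤ M - 1)
    (hy : 2 ≤ y) (hy' : y ≤ 2 * M - 2) (hy2 : y % 2 = 0) : Reach w M (x, y) := by
  by_cases c : y = 2
  · exact (reach_row_one (x := 2 * x) (by omega) (by omega)).step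
  have h : Reach w M (1, y - 1) :=
    reach_odd_row_left hM le_rfl (by omega) (by omega) (by omega) (by omega)
  have h' : Reach w M (1, y - 1 + 1) := h.step
  have h1 := reach_odd_strip hM (by omega) (by omega) (by omega) h' (x - 1).toNat (by omega)
  have e : 1 + ((x - 1).toNat : ℤ) = x := by omega
  rwa [e, sub_add_cancel] at h1

theorem reach_last_row_odd {w M : ℤ} (hM : 3 ≤ M) (j : ℕ) (hj : j + 1 ≤ M) :
    Reach w M (2 * j + 1, 2 * M) := by
  induction j with
  | zero =>
    have h : Reach w M (1, 2 * M - 1) :=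
      reach_odd_row_left hM le_rfl (by omega) (by omega) (by omega) (by omega)
    exact h.step
  | succ j ih =>
    push_cast at hj ⊢
    have h1 : Reach w M (2 * j + 2, 2 * M) := (ih (by omega)).step
    have h2 : Reach w M (M + 2 + j, 2 * M - 1) := h1.step
    exact h2.step

theorem reach_last_row {w M x : ℤ} (hM : 3 ≤ M) (hx : 1 ≤ x) (hx' : x ≤ 2 * M) :
    Reach w M (x, 2 * M) := by
  have h := reach_last_row_odd (w := w) hM ((x - 1) / 2).toNat (by omega)
  have e : (((x - 1) / 2).toNat : ℤ) = (x - 1) / 2 := Int.toNat_of_nonneg (by omega)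
  rw [e] at h
  by_cases hx2 : x % 2 = 1
  · convert h using 2
    omega
  · exact h.step

theorem reach_odd_row_right {w M x y : ℤ} (hM : 3 ≤ M) (hx : M + 2 ≤ x) (hx' : x ≤ 2 * M)
    (hy : 3 ≤ y) (hy' : y ≤ 2 * M - 1) (hy2 : y % 2 = 1) : Reach w M (x, y) := by
  by_cases c : y = 2 * M - 1
  · exact (reach_last_row (x := 2 * (x - M - 1)) hM (by omega) (by omega)).step
  · exact (reach_even_row_left (x := x - M - 1) (y := y + 1) hM (by omega) (by omega) (by omega)
      (by omega) (by omega)).step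

theorem reach_block {w M x y : ℤ} (hM : 3 ≤ M) (hx : 1 ≤ x) (hx' : x ≤ 2 * M) (hy : 1 ≤ y)
    (hy' : y ≤ 2 * M) : Reach w M (x, y) := by
  by_cases c1 : y = 1
  · subst c1
    exact reach_row_one hx hx'
  by_cases c2 : y = 2 * M
  · subst c2
    exact reach_last_row hM hx hx'
  by_cases c3 : y % 2 = 0
  · by_cases c4 : x ≤ M - 1
    · exact reach_even_row_left hM hx c4 (by omega) (by omega) c3
    · exact reach_even_row_right hM (by omega) hx' (by omega) (by omega) c3
  · by_cases c4 : x ≤ M + 1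
    · exact reach_odd_row_left hM hx c4 (by omega) (by omega) (by omega)
    · exact reach_odd_row_right hM (by omega) hx' (by omega) (by omega) (by omega)

theorem reach_top_two {M : ℤ} (hM : 3 ≤ M) (j : ℕ) (hj : j + 1 ≤ M) :
    Reach 2 M (2 * M - 2 * j, 2 * M + 1) := by
  induction j with
  | zero =>
    have h : Reach 2 M (2 * M, 2 * M) := reach_block hM (by omega) le_rfl (by omega) le_rfl
    exact h.step
  | succ j ih =>
    push_cast at hj ⊢
    have h1 : Reach 2 M (2 * M - 2 * j - 1, 2 * M + 1) := (ih (by omega)).step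
    have h2 : Reach 2 M (2 * M - 2 * j, 2 * M + 2) := h1.step
    have h3 : Reach 2 M (2 * M - 2 * j - 1, 2 * M + 2) := h2.step
    exact h3.step

theorem reach_top_three {M : ℤ} (hM : 3 ≤ M) (j : ℕ) (hj : j + 2 ≤ M) :
    Reach 3 M (2 * M - 2 * j, 2 * M + 1) := by
  induction j with
  | zero =>
    have h : Reach 3 M (2 * M, 2 * M) := reach_block hM (by omega) le_rfl (by omega) le_rfl
    exact h.step
  | succ j ih =>
    push_cast at hj ⊢
    have h1 : Reach 3 M (2 * M - 2 * j - 1, 2 * M + 1) := (ih (by omega)).step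
    have h2 : Reach 3 M (2 * M - 2 * j, 2 * M + 2) := h1.step
    have h3 : Reach 3 M (2 * M - 2 * j, 2 * M + 3) := h2.step
    have h4 : Reach 3 M (2 * M - 2 * j - 1, 2 * M + 3) := h3.step
    have h5 : Reach 3 M (2 * M - 2 * j - 1, 2 * M + 2) := h4.step
    exact h5.step

theorem reach_top_two_even {M x : ℤ} (hM : 3 ≤ M) (hx : 1 ≤ x) (hx' : x ≤ 2 * M)
    (h : x % 2 = 0) : Reach 2 M (x, 2 * M + 1) := by
  have h := reach_top_two hM (M - x / 2).toNat (by omega)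
  convert h using 2
  omega

theorem reach_top_three_even {M x : ℤ} (hM : 3 ≤ M) (hx : 3 ≤ x) (hx' : x ≤ 2 * M)
    (h : x % 2 = 0) : Reach 3 M (x, 2 * M + 1) := by
  have h := reach_top_three hM (M - x / 2).toNat (by omega)
  convert h using 2
  omega

theorem reach_frame_two {M x y : ℤ} (hM : 3 ≤ M) (hx : 1 ≤ x) (hx' : x ≤ 2 * M)
    (hy : 2 * M < y) (hy' : y ≤ 2 * M + 2) : Reach 2 M (x, y) := by
  by_cases c : x % 2 = 0
  · have h1 := reach_top_two_even hM hx hx' c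
    have h2 : Reach 2 M (x - 1, 2 * M + 1) := h1.step
    have h3 : Reach 2 M (x, 2 * M + 2) := h2.step
    obtain rfl | rfl : y = 2 * M + 1 ∨ y = 2 * M + 2 := by omega
    exacts [h1, h3]
  · have h1 := reach_top_two_even (x := x + 1) hM (by omega) (by omega) (by omega)
    have h2 : Reach 2 M (x, 2 * M + 1) := h1.step
    have h3 : Reach 2 M (x + 1, 2 * M + 2) := h2.step
    have h4 : Reach 2 M (x, 2 * M + 2) := h3.step
    obtain rfl | rfl : y = 2 * M + 1 ∨ y = 2 * M + 2 := by omega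
    exacts [h2, h4]

theorem reach_frame_three {M x y : ℤ} (hM : 3 ≤ M) (hx : 3 ≤ x) (hx' : x ≤ 2 * M)
    (hy : 2 * M < y) (hy' : y ≤ 2 * M + 3) : Reach 3 M (x, y) := by
  by_cases c : x % 2 = 0
  · have h1 := reach_top_three_even hM hx hx' c
    have h2 : Reach 3 M (x - 1, 2 * M + 1) := h1.step
    have h3 : Reach 3 M (x, 2 * M + 2) := h2.step
    have h4 : Reach 3 M (x, 2 * M + 3) := h3.step
    obtain rfl | rfl | rfl : y = 2 * M + 1 ∨ y = 2 * M + 2 ∨ y = 2 * M + 3 := by omega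
    exacts [h1, h3, h4]
  · have h1 := reach_top_three_even (x := x + 1) hM (by omega) (by omega) (by omega)
    have h2 : Reach 3 M (x, 2 * M + 1) := h1.step
    have h3 : Reach 3 M (x + 1, 2 * M + 2) := h2.step
    have h4 : Reach 3 M (x + 1, 2 * M + 3) := h3.step
    have h5 : Reach 3 M (x, 2 * M + 3) := h4.step
    have h6 : Reach 3 M (x, 2 * M + 2) := h5.step
    obtain rfl | rfl | rfl : y = 2 * M + 1 ∨ y = 2 * M + 2 ∨ y = 2 * M + 3 := by omega
    exacts [h2, h6, h5]

theorem reach_corner_two {M : ℤ} (hM : 3 ≤ M) {x k : ℤ}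
    (hx : -1 ≤ x) (hx' : x ≤ 0) (hk : -2 ≤ k) (hk' : k ≤ 2)
    (h : -1 ≤ k ∨ x = -1) : Reach 2 M (x, 2 * M + k) := by
  have h0 : Reach 2 M (1, 2 * M + 2) :=
    reach_frame_two hM (by omega) (by omega) (by omega) (by omega)
  have h1 : Reach 2 M (0, 2 * M + 1) := h0.step
  have h2 : Reach 2 M (0, 2 * M + 2) := h1.step
  have h3 : Reach 2 M (-1, 2 * M + 2) := h2.step
  have h4 : Reach 2 M (-1, 2 * M + 1) := h3.step
  have h5 : Reach 2 M (0, 2 * M + 0) := h4.step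
  have h6 : Reach 2 M (-1, 2 * M + 0) := h5.step
  have h7 : Reach 2 M (-1, 2 * M + -1) := h6.step
  have h8 : Reach 2 M (0, 2 * M + -1) := h7.step
  have h9 : Reach 2 M (-1, 2 * M + -2) := h8.step
  interval_cases x <;> interval_cases k <;>
    first | assumption | omega

theorem reach_corner_three {M : ℤ} (hM : 3 ≤ M) {x k : ℤ}
    (hx : -2 ≤ x) (hx' : x ≤ 2) (hk : -2 ≤ k) (hk' : k ≤ 3)
    (h : -1 ≤ k ∧ (x ≤ 0 ∨ 0 < k) ∨ x = -2) : Reach 3 M (x, 2 * M + k) := by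
  have h0 : Reach 3 M (3, 2 * M + 2) :=
    reach_frame_three hM (by omega) (by omega) (by omega) (by omega)
  have h1 : Reach 3 M (2, 2 * M + 3) := h0.step
  have h2 : Reach 3 M (1, 2 * M + 3) := h1.step
  have h3 : Reach 3 M (1, 2 * M + 2) := h2.step
  have h4 : Reach 3 M (0, 2 * M + 3) := h3.step
  have h5 : Reach 3 M (-1, 2 * M + 3) := h4.step
  have h6 : Reach 3 M (0, 2 * M + 2) := h5.step
  have h7 : Reach 3 M (-2, 2 * M + 3) := h6.step
  have h8 : Reach 3 M (-1, 2 * M + 2) := h7.step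
  have h9 : Reach 3 M (-2, 2 * M + 2) := h8.step
  have h10 : Reach 3 M (-2, 2 * M + 1) := h9.step
  have h11 : Reach 3 M (-1, 2 * M + 1) := h10.step
  have h12 : Reach 3 M (2, 2 * M + 2) := h11.step
  have h13 : Reach 3 M (1, 2 * M + 1) := h12.step
  have h14 : Reach 3 M (2, 2 * M + 1) := h13.step
  have h15 : Reach 3 M (-1, 2 * M + 0) := h14.step
  have h16 : Reach 3 M (0, 2 * M + 1) := h15.step
  have h17 : Reach 3 M (-2, 2 * M + 0) := h16.step
  have h18 : Reach 3 M (-2, 2 * M + -1) := h17.step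
  have h19 : Reach 3 M (-1, 2 * M + -1) := h18.step
  have h20 : Reach 3 M (0, 2 * M + 0) := h19.step
  have h21 : Reach 3 M (0, 2 * M + -1) := h20.step
  have h22 : Reach 3 M (-2, 2 * M + -2) := h21.step
  interval_cases x <;> interval_cases k <;>
    first | assumption | omega

theorem reach_ladder_start {w M : ℤ} (hw : w = 2 ∨ w = 3) (hM : 3 ≤ M) :
    Reach w M (1 - w, 2 * M + -2) := by
  obtain rfl | rfl := hw
  · exact reach_corner_two hM (by norm_num) (by norm_num) (by norm_num) (by norm_num)
      (by norm_num)
  · exact reach_corner_three hM (by norm_num) (by norm_num) (by norm_num) (by norm_num)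
      (by norm_num)

theorem reach_ladder_pair {w M y : ℤ} (hw : w = 2 ∨ w = 3) (hy : 4 ≤ y) (hy' : y ≤ 2 * M - 2)
    (hy2 : y % 2 = 0) (h : Reach w M (1 - w, y)) :
    (∀ x, 1 - w ≤ x → x ≤ 0 → Reach w M (x, y) ∧ Reach w M (x, y - 1)) ∧
      Reach w M (1 - w, y - 2) := by
  have h1 : Reach w M (1 - w, y - 1) := h.step
  have h2 : Reach w M (2 - w, y) := h1.step
  have h3 : Reach w M (2 - w, y - 1) := h2.step
  obtain rfl | rfl := hw
  · refine ⟨fun x hx hx' => ?_, h3.step⟩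
    obtain rfl | rfl : x = -1 ∨ x = 0 := by omega
    exacts [⟨h, h1⟩, ⟨h2, h3⟩]
  · have h4 : Reach 3 M (0, y) := h3.step
    have h5 : Reach 3 M (0, y - 1) := h4.step
    refine ⟨fun x hx hx' => ?_, h5.step⟩
    obtain rfl | rfl | rfl : x = -2 ∨ x = -1 ∨ x = 0 := by omega
    exacts [⟨h, h1⟩, ⟨h2, h3⟩, ⟨h4, h5⟩]

theorem reach_ladder_left {w M : ℤ} (hw : w = 2 ∨ w = 3) (hM : 3 ≤ M) (k : ℕ) (hk : k + 2 ≤ M) :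
    Reach w M (1 - w, 2 * M - 2 - 2 * k) := by
  induction k with
  | zero => simpa [sub_eq_add_neg] using reach_ladder_start hw hM
  | succ k ih =>
    push_cast at hk ⊢
    convert (reach_ladder_pair hw (by omega) (by omega) (by omega) (ih (by omega))).2 using 2
    ring

theorem reach_ladder_left' {w M y : ℤ} (hw : w = 2 ∨ w = 3) (hM : 3 ≤ M) (hy : 2 ≤ y)
    (hy' : y ≤ 2 * M - 2) (hy2 : y % 2 = 0) : Reach w M (1 - w, y) := by
  convert reach_ladder_left hw hM (M - 1 - y / 2).toNat (by omega) using 2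
  omega

theorem reach_ladder_bottom {w M : ℤ} (hw : w = 2 ∨ w = 3) (hM : 3 ≤ M) {x : ℤ} (hx : 1 - w ≤ x)
    (hx' : x ≤ 0) : Reach w M (x, 1) ∧ Reach w M (x, 2) := by
  have h : Reach w M (1 - w, 2) := reach_ladder_left' hw hM le_rfl (by omega) rfl
  have h1 : Reach w M (1 - w, 1) := h.step
  have h2 : Reach w M (2 - w, 1) := h1.step
  have h3 : Reach w M (2 - w, 2) := h2.step
  obtain rfl | rfl := hw
  · obtain rfl | rfl : x = -1 ∨ x = 0 := by omega
    exacts [⟨h1, h⟩, ⟨h2, h3⟩]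
  · have h4 : Reach 3 M (0, 1) := h3.step
    have h5 : Reach 3 M (0, 2) := h4.step
    obtain rfl | rfl | rfl : x = -2 ∨ x = -1 ∨ x = 0 := by omega
    exacts [⟨h1, h⟩, ⟨h2, h3⟩, ⟨h4, h5⟩]

theorem reach_ladder {w M x y : ℤ} (hw : w = 2 ∨ w = 3) (hM : 3 ≤ M) (hx : 1 - w ≤ x)
    (hx' : x ≤ 0) (hy : 1 ≤ y) (hy' : y ≤ 2 * M - 2) : Reach w M (x, y) := by
  by_cases c1 : y = 1
  · rw [c1]
    exact (reach_ladder_bottom hw hM hx hx').1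
  by_cases c2 : y = 2
  · rw [c2]
    exact (reach_ladder_bottom hw hM hx hx').2
  by_cases c3 : y % 2 = 0
  · exact ((reach_ladder_pair hw (by omega) hy' c3
      (reach_ladder_left' hw hM (by omega) hy' c3)).1 x hx hx').1
  · have h := ((reach_ladder_pair hw (y := y + 1) (by omega) (by omega) (by omega)
      (reach_ladder_left' hw hM (by omega) (by omega) (by omega))).1 x hx hx').2
    rwa [add_sub_cancel_right] at h

theorem reach_of_inRange {w M : ℤ} (hw : w = 2 ∨ w = 3) (hM : 3 ≤ M) {p : ℤ × ℤ}
    (hp : InRange w M p) : Reach w M p := by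
  obtain ⟨x, y⟩ := p
  obtain ⟨h1, h2, h3, h4⟩ := hp
  dsimp only at h1 h2 h3 h4
  by_cases c1 : y ≤ 2 * M ∧ 1 ≤ x
  · exact reach_block hM c1.2 h2 h3 c1.1
  by_cases c2 : y ≤ 2 * M - 2
  · exact reach_ladder hw hM h1 (by omega) h3 c2
  obtain ⟨k, rfl⟩ : ∃ k, y = 2 * M + k := ⟨y - 2 * M, by ring⟩
  obtain rfl | rfl := hw
  · by_cases c3 : 1 ≤ x
    · exact reach_frame_two hM c3 h2 (by omega) h4
    · exact reach_corner_two hM h1 (by omega) (by omega) (by omega) (by omega)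
  · by_cases c3 : 3 ≤ x
    · exact reach_frame_three hM c3 h2 (by omega) h4
    · exact reach_corner_three hM h1 (by omega) (by omega) (by omega) (by omega)

theorem polyNext_last {w M : ℤ} (hM : 3 ≤ M) (hw : w = 2 ∨ w = 3) :
    polyNext w M (0, 2) = (1, 1) := by
  rw [polyNext_mk, if_neg (by omega), if_pos (by omega), ladderNext, if_neg (by omega),
    if_pos rfl, if_neg (by omega), zero_add]

/-- A finite set which is a single cycle of a self-map is parametrized by `ZMod`. -/
theorem exists_zmod_parametrization {α : Type*} {F : α → α} {S : Set α} {N : ℕ} [NeZero N] {p₀ : α}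
    (hN : S.ncard = N) (h₀ : p₀ ∈ S) (hF : ∀ p ∈ S, F p ∈ S)
    (hreach : ∀ p ∈ S, ∃ i : ℕ, F^[i] p₀ = p) (hlast : ∃ p ∈ S, F p = p₀) :
    ∃ f : ZMod N → α, f.Injective ∧ Set.range f = S ∧ ∀ i, f (i + 1) = F (f i) := by
  obtain ⟨q, hq, hq'⟩ := hlast
  obtain ⟨k, hk⟩ := hreach q hq
  have hper : p₀ ∈ Function.periodicPts F :=
    ⟨k + 1, k.succ_pos, by
      rw [Function.IsPeriodicPt, Function.IsFixedPt, Function.iterate_succ_apply', hk, hq']⟩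
  have hmem : ∀ i : ℕ, F^[i] p₀ ∈ S := by
    intro i
    induction i with
    | zero => exact h₀
    | succ i ih =>
      rw [Function.iterate_succ_apply']
      exact hF _ ih
  have hpos := Function.minimalPeriod_pos_of_mem_periodicPts hper
  have hinj := Function.iterate_injOn_Iio_minimalPeriod (f := F) (x := p₀)
  have himage : (fun i : ℕ => F^[i] p₀) '' Set.Iio (Function.minimalPeriod F p₀) = S := by
    ext p
    constructor
    · rintro ⟨i, -, rfl⟩
      exact hmem i
    · intro hp
      obtain ⟨i, hi⟩ := hreach p hp
      exact ⟨i % Function.minimalPeriod F p₀, Nat.mod_lt _ hpos, by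
        dsimp only
        rw [Function.iterate_mod_minimalPeriod_eq, hi]⟩
  have hT : Function.minimalPeriod F p₀ = N := by
    rw [← hN, ← himage, hinj.ncard_image, ← Finset.coe_Iio, Set.ncard_coe_finset,
      Nat.card_Iio]
  rw [hT] at hinj himage
  refine ⟨fun i => F^[i.val] p₀, fun i j hij => ?_, ?_, fun i => ?_⟩
  · exact ZMod.val_injective N (hinj (ZMod.val_lt i) (ZMod.val_lt j) hij)
  · rw [← himage]
    ext p
    constructor
    · rintro ⟨i, rfl⟩
      exact ⟨i.val, ZMod.val_lt i, rfl⟩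
    · rintro ⟨i, hi, rfl⟩
      exact ⟨i, by dsimp only; rw [ZMod.val_cast_of_lt hi]⟩
  · dsimp only
    rw [← Function.iterate_succ_apply' F, ZMod.val_add, ZMod.val_one_eq_one_mod, Nat.add_mod_mod]
    have h := Function.iterate_mod_minimalPeriod_eq (f := F) (x := p₀) (n := i.val + 1)
    rwa [hT] at h

theorem gridSet_eq_coe (n : ℕ) :
    gridSet n = ((Finset.Icc (1 : ℤ) n ×ˢ Finset.Icc (1 : ℤ) n : Finset (ℤ × ℤ)) : Set (ℤ × ℤ)) := by
  ext p
  simp only [gridSet, Set.mem_ofPred_eq, Finset.coe_product, Set.mem_prod, Finset.coe_Icc,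
    Set.mem_Icc, and_assoc]

theorem ncard_gridSet (n : ℕ) : (gridSet n).ncard = n ^ 2 := by
  rw [gridSet_eq_coe, Set.ncard_coe_finset, Finset.card_product, Int.card_Icc]
  simp [sq]

/-- An edge compatible with the barriers `g`, oriented upwards or to the right. -/
def IsUpEdge (g : ℤ → ℤ → ℤ) (u v : ℤ × ℤ) : Prop :=
  (v.2 = u.2 ∧ v.1 = u.1 + 1) ∨ (v.2 = u.2 + 1 ∧ g u.2 u.1 ≤ v.1 ∧ v.1 ≤ g u.2 (u.1 + 1))

theorem IsEdge.isUpEdge {g : ℤ → ℤ → ℤ} {p q : ℤ × ℤ} (h : IsEdge g p q) :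
    IsUpEdge g p q ∨ IsUpEdge g q p := by
  obtain ⟨h1, h2 | h2⟩ | h | h := h
  · exact Or.inl (Or.inl ⟨h1, h2⟩)
  · exact Or.inr (Or.inl ⟨h1.symm, by omega⟩)
  · exact Or.inl (Or.inr h)
  · exact Or.inr (Or.inr h)

theorem exists_of_mem_segment_toR2 {u v : ℤ × ℤ} {z : ℝ × ℝ}
    (hz : z ∈ segment ℝ (toR2 u) (toR2 v)) :
    ∃ t : ℝ, 0 ≤ t ∧ t ≤ 1 ∧ z.1 = u.1 + t * (v.1 - u.1) ∧ z.2 = u.2 + t * (v.2 - u.2) := by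
  obtain ⟨s, t, hs, ht, hst, rfl⟩ := hz
  obtain rfl : s = 1 - t := by linarith
  refine ⟨t, ht, by linarith, ?_, ?_⟩ <;>
    simp only [toR2, Prod.fst_add, Prod.snd_add, Prod.smul_fst, Prod.smul_snd, smul_eq_mul] <;> ring

theorem eq_toR2_iff {u : ℤ × ℤ} {z : ℝ × ℝ} : z = toR2 u ↔ z.1 = u.1 ∧ z.2 = u.2 := Prod.ext_iff

theorem strip_inter_of_lt {g : ℤ → ℤ → ℤ} (hg : ∀ y, Monotone (g y)) {u v u' v' : ℤ × ℤ}
    {z : ℝ × ℝ} (hv : v.2 = u.2 + 1) (hv' : v'.2 = u'.2 + 1) (hle : v.1 ≤ g u.2 (u.1 + 1))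
    (hle' : g u'.2 u'.1 ≤ v'.1) (hrow : u.2 = u'.2) (hlt : u.1 < u'.1)
    (hz : z ∈ segment ℝ (toR2 u) (toR2 v)) (hz' : z ∈ segment ℝ (toR2 u') (toR2 v')) :
    z = toR2 v ∧ z = toR2 v' := by
  obtain ⟨t, ht0, ht1, h1, h2⟩ := exists_of_mem_segment_toR2 hz
  obtain ⟨t', -, -, h1', h2'⟩ := exists_of_mem_segment_toR2 hz'
  have hb : v.1 ≤ v'.1 := (hle.trans (hg u.2 (Int.add_one_le_iff.2 hlt))).trans
    (hrow.symm ▸ hle')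
  have hb' : (v.1 : ℝ) ≤ v'.1 := by exact_mod_cast hb
  have ha : (u.1 : ℝ) + 1 ≤ u'.1 := by exact_mod_cast hlt
  rw [hv] at h2
  rw [hv', ← hrow] at h2'
  push_cast at h2 h2'
  obtain rfl : t = t' := by linarith
  obtain rfl : t = 1 := by nlinarith
  simp only [eq_toR2_iff, hv, hv', ← hrow]
  push_cast
  refine ⟨⟨?_, ?_⟩, ?_, ?_⟩ <;> linarith

theorem row_inter_strip {u v u' v' : ℤ × ℤ} {z : ℝ × ℝ} (hu : v.2 = u.2) (hv : v.1 = u.1 + 1)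
    (hv' : v'.2 = u'.2 + 1) (hz : z ∈ segment ℝ (toR2 u) (toR2 v))
    (hz' : z ∈ segment ℝ (toR2 u') (toR2 v')) :
    (z = toR2 u ∨ z = toR2 v) ∧ (z = toR2 u' ∨ z = toR2 v') := by
  obtain ⟨t, ht0, ht1, h1, h2⟩ := exists_of_mem_segment_toR2 hz
  obtain ⟨t', ht0', ht1', h1', h2'⟩ := exists_of_mem_segment_toR2 hz'
  rw [hu] at h2
  rw [hv] at h1
  rw [hv'] at h2'
  push_cast at h1 h2 h2'
  have e1 : (u'.2 : ℝ) ≤ u.2 := by linarith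
  have e2 : (u.2 : ℝ) ≤ u'.2 + 1 := by linarith
  have e1' : u'.2 ≤ u.2 := by exact_mod_cast e1
  have e2' : u.2 ≤ u'.2 + 1 := by exact_mod_cast e2
  have key : ∃ c : ℤ, z.1 = c ∧ (z = toR2 u' ∨ z = toR2 v') := by
    obtain h | h : u.2 = u'.2 ∨ u.2 = u'.2 + 1 := by omega
    · have h' : (u.2 : ℝ) = u'.2 := by exact_mod_cast h
      obtain rfl : t' = 0 := by linarith
      have e : z.1 = u'.1 := by linarith
      exact ⟨_, e, Or.inl (eq_toR2_iff.2 ⟨e, by linarith⟩)⟩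
    · have h' : (u.2 : ℝ) = u'.2 + 1 := by exact_mod_cast h
      obtain rfl : t' = 1 := by linarith
      have e : z.1 = v'.1 := by linarith
      exact ⟨_, e, Or.inr (eq_toR2_iff.2 ⟨e, by rw [hv']; push_cast; linarith⟩)⟩
  obtain ⟨c, hc, hzc⟩ := key
  refine ⟨?_, hzc⟩
  have d1 : (u.1 : ℝ) ≤ c := by linarith
  have d2 : (c : ℝ) ≤ u.1 + 1 := by linarith
  have d1' : u.1 ≤ c := by exact_mod_cast d1
  have d2' : c ≤ u.1 + 1 := by exact_mod_cast d2
  obtain rfl | rfl : c = u.1 ∨ c = u.1 + 1 := by omega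
  · exact Or.inl (eq_toR2_iff.2 ⟨hc, by linarith⟩)
  · exact Or.inr (eq_toR2_iff.2 ⟨by rw [hv, hc], by rw [hu]; linarith⟩)

theorem strip_inter_of_row_lt {u v u' v' : ℤ × ℤ} {z : ℝ × ℝ} (hv : v.2 = u.2 + 1)
    (hv' : v'.2 = u'.2 + 1) (hrow : u.2 < u'.2) (hz : z ∈ segment ℝ (toR2 u) (toR2 v))
    (hz' : z ∈ segment ℝ (toR2 u') (toR2 v')) : z = toR2 v ∧ z = toR2 u' := by
  obtain ⟨t, ht0, ht1, h1, h2⟩ := exists_of_mem_segment_toR2 hz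
  obtain ⟨t', ht0', ht1', h1', h2'⟩ := exists_of_mem_segment_toR2 hz'
  rw [hv] at h2
  rw [hv'] at h2'
  push_cast at h2 h2'
  have e : (u.2 : ℝ) + 1 ≤ u'.2 := by exact_mod_cast hrow
  obtain rfl : t = 1 := by linarith
  obtain rfl : t' = 0 := by linarith
  simp only [eq_toR2_iff, hv]
  push_cast
  refine ⟨⟨?_, ?_⟩, ?_, ?_⟩ <;> linarith

theorem row_inter_of_lt {u v u' v' : ℤ × ℤ} {z : ℝ × ℝ} (hu : v.2 = u.2) (hv : v.1 = u.1 + 1)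
    (hu' : v'.2 = u'.2) (hv' : v'.1 = u'.1 + 1) (hlt : u.1 < u'.1)
    (hz : z ∈ segment ℝ (toR2 u) (toR2 v)) (hz' : z ∈ segment ℝ (toR2 u') (toR2 v')) :
    z = toR2 v ∧ z = toR2 u' := by
  obtain ⟨t, ht0, ht1, h1, h2⟩ := exists_of_mem_segment_toR2 hz
  obtain ⟨t', ht0', ht1', h1', h2'⟩ := exists_of_mem_segment_toR2 hz'
  rw [hu] at h2
  rw [hu'] at h2'
  rw [hv] at h1
  rw [hv'] at h1'
  push_cast at h1 h1'
  have e : (u.1 : ℝ) + 1 ≤ u'.1 := by exact_mod_cast hlt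
  simp only [eq_toR2_iff, hu, hv]
  push_cast
  refine ⟨⟨?_, ?_⟩, ?_, ?_⟩ <;> linarith

theorem IsUpEdge.inter {g : ℤ → ℤ → ℤ} (hg : ∀ y, Monotone (g y)) {u v u' v' : ℤ × ℤ} {z : ℝ × ℝ}
    (h : IsUpEdge g u v) (h' : IsUpEdge g u' v') (hne : ¬ (u = u' ∧ v = v'))
    (hz : z ∈ segment ℝ (toR2 u) (toR2 v)) (hz' : z ∈ segment ℝ (toR2 u') (toR2 v')) :
    (z = toR2 u ∨ z = toR2 v) ∧ (z = toR2 u' ∨ z = toR2 v') := by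
  obtain ⟨h1, h2⟩ | ⟨h1, h2, h3⟩ := h <;> obtain ⟨h1', h2'⟩ | ⟨h1', h2', h3'⟩ := h'
  · obtain c | c | c := lt_trichotomy u.1 u'.1
    · exact (row_inter_of_lt h1 h2 h1' h2' c hz hz').imp Or.inr Or.inl
    · exfalso
      obtain ⟨t, -, -, -, h4⟩ := exists_of_mem_segment_toR2 hz
      obtain ⟨t', -, -, -, h4'⟩ := exists_of_mem_segment_toR2 hz'
      rw [h1] at h4
      rw [h1'] at h4'
      have e : (u.2 : ℝ) = u'.2 := by linarith
      have e' : u.2 = u'.2 := by exact_mod_cast e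
      exact hne ⟨Prod.ext c e', Prod.ext (by omega) (by omega)⟩
    · exact ((row_inter_of_lt h1' h2' h1 h2 c hz' hz).imp Or.inr Or.inl).symm
  · exact row_inter_strip h1 h2 h1' hz hz'
  · exact (row_inter_strip h1' h2' h1 hz' hz).symm
  · obtain r | r | r := lt_trichotomy u.2 u'.2
    · exact (strip_inter_of_row_lt h1 h1' r hz hz').imp Or.inr Or.inl
    · obtain c | c | c := lt_trichotomy u.1 u'.1
      · exact (strip_inter_of_lt hg h1 h1' h3 h2' r c hz hz').imp Or.inr Or.inr
      · have hu : u = u' := Prod.ext c r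
        subst hu
        have hv : v.1 ≠ v'.1 := fun e => hne ⟨rfl, Prod.ext e (by omega)⟩
        have hv' : (v.1 : ℝ) - v'.1 ≠ 0 := sub_ne_zero.2 (by exact_mod_cast hv)
        obtain ⟨t, -, -, h4, h5⟩ := exists_of_mem_segment_toR2 hz
        obtain ⟨t', -, -, h4', h5'⟩ := exists_of_mem_segment_toR2 hz'
        rw [h1] at h5
        rw [h1'] at h5'
        push_cast at h5 h5'
        obtain rfl : t = t' := by linarith
        have h6 : t * (v.1 - v'.1) = 0 := by linarith
        obtain rfl : t = 0 := (mul_eq_zero.1 h6).resolve_right hv'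
        have e : z = toR2 u := eq_toR2_iff.2 ⟨by linarith, by linarith⟩
        exact ⟨Or.inl e, Or.inl e⟩
      · exact ((strip_inter_of_lt hg h1' h1 h3' h2 r.symm c hz' hz).imp Or.inr Or.inr).symm
    · exact ((strip_inter_of_row_lt h1' h1 r hz' hz).imp Or.inr Or.inl).symm

theorem IsEdge.inter_subset {g : ℤ → ℤ → ℤ} (hg : ∀ y, Monotone (g y)) {p q p' q' : ℤ × ℤ}
    (h : IsEdge g p q) (h' : IsEdge g p' q') (hne : ¬ (p = p' ∧ q = q'))
    (hne' : ¬ (p = q' ∧ q = p')) :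
    segment ℝ (toR2 p) (toR2 q) ∩ segment ℝ (toR2 p') (toR2 q') ⊆
      ({toR2 p, toR2 q} : Set (ℝ × ℝ)) ∩ ({toR2 p', toR2 q'} : Set (ℝ × ℝ)) := by
  rintro z ⟨hz, hz'⟩
  simp only [Set.mem_inter_iff, Set.mem_insert_iff, Set.mem_singleton_iff]
  obtain h | h := h.isUpEdge <;> obtain h' | h' := h'.isUpEdge
  · exact h.inter hg h' hne hz hz'
  · rw [segment_symm] at hz'
    exact (h.inter hg h' hne' hz hz').imp id Or.symm
  · rw [segment_symm] at hz
    exact (h.inter hg h' (fun e => hne' e.symm) hz hz').imp Or.symm id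
  · rw [segment_symm] at hz hz'
    exact (h.inter hg h' (fun e => hne e.symm) hz hz').imp Or.symm Or.symm

theorem IsTurn.not_collinear {g : ℤ → ℤ → ℤ} {p q r : ℤ × ℤ} (h : IsTurn p q r)
    (hpq : IsEdge g p q) (hqr : IsEdge g q r) (hne : p ≠ r) :
    ¬ Collinear ℝ ({toR2 p, toR2 q, toR2 r} : Set (ℝ × ℝ)) := by
  intro hc
  rw [collinear_iff_of_mem (p₀ := toR2 p) (by simp)] at hc
  obtain ⟨v, hv⟩ := hc
  obtain ⟨a, ha⟩ := hv (toR2 q) (by simp)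
  obtain ⟨b, hb⟩ := hv (toR2 r) (by simp)
  simp only [toR2, Prod.ext_iff, vadd_eq_add, Prod.fst_add, Prod.snd_add, Prod.smul_fst,
    Prod.smul_snd, smul_eq_mul] at ha hb
  have hdet' : ((q.1 : ℝ) - p.1) * (r.2 - q.2) = (q.2 - p.2) * (r.1 - q.1) := by
    rw [ha.1, ha.2, hb.1, hb.2]
    ring
  have hdet : (q.1 - p.1) * (r.2 - q.2) = (q.2 - p.2) * (r.1 - q.1) := by exact_mod_cast hdet'
  obtain ⟨t1, t2⟩ := h
  have hne' : ¬ (p.1 = r.1 ∧ p.2 = r.2) := fun e => hne (Prod.ext e.1 e.2)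
  have c1 : q.2 - p.2 = 0 ∧ (q.1 - p.1 = 1 ∨ q.1 - p.1 = -1) ∨ q.2 - p.2 = 1 ∨ q.2 - p.2 = -1 := by
    unfold IsEdge at hpq
    omega
  have c2 : r.2 - q.2 = 0 ∧ (r.1 - q.1 = 1 ∨ r.1 - q.1 = -1) ∨ r.2 - q.2 = 1 ∨ r.2 - q.2 = -1 := by
    unfold IsEdge at hqr
    omega
  obtain ⟨e1, e2 | e2⟩ | e1 | e1 := c1 <;> obtain ⟨e3, e4 | e4⟩ | e3 | e3 := c2 <;>
    rw [e1, e3] at hdet <;> omega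

/-- A self-map of the grid that is a single cycle and whose steps are compatible with monotone
barriers and turn at every vertex yields a proper polygon. -/
theorem exists_proper_polygon {n : ℕ} (hn : 2 ≤ n) {F : ℤ × ℤ → ℤ × ℤ} {g : ℤ → ℤ → ℤ}
    {p₀ : ℤ × ℤ} (hg : ∀ y, Monotone (g y)) (h₀ : p₀ ∈ gridSet n)
    (hF : ∀ p ∈ gridSet n, F p ∈ gridSet n) (hreach : ∀ p ∈ gridSet n, ∃ i : ℕ, F^[i] p₀ = p)
    (hlast : ∃ p ∈ gridSet n, F p = p₀) (hedge : ∀ p ∈ gridSet n, IsEdge g p (F p))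
    (hturn : ∀ p ∈ gridSet n, IsTurn p (F p) (F (F p))) :
    ∃ f, IsSimpleClosedGridPolygon n f ∧ IsProper n f ∧ ∀ i, f (i + 1) = F (f i) := by
  have : NeZero (n ^ 2) := ⟨by positivity⟩
  have htwo : (2 : ZMod (n ^ 2)) ≠ 0 := by
    intro h
    have h' : ((2 : ℕ) : ZMod (n ^ 2)) = 0 := by exact_mod_cast h
    have := Nat.le_of_dvd two_pos ((ZMod.natCast_eq_zero_iff _ _).1 h')
    nlinarith
  obtain ⟨f, hinj, hrange, hf⟩ :=
    exists_zmod_parametrization (ncard_gridSet n) h₀ hF hreach hlast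
  have hmem : ∀ i, f i ∈ gridSet n := fun i => hrange ▸ Set.mem_range_self i
  refine ⟨f, ⟨hinj, hrange, fun i j hij => ?_⟩, fun i => ?_, hf⟩
  · refine IsEdge.inter_subset hg (hf i ▸ hedge _ (hmem i)) (hf j ▸ hedge _ (hmem j))
      (fun e => hij (hinj e.1)) fun e => htwo ?_
    have e1 := hinj e.1
    have e2 := hinj e.2
    rw [e1] at e2
    linear_combination e2
  · have e : f (i + 2) = F (F (f i)) := by rw [← hf, ← hf, add_assoc, one_add_one_eq_two]
    have hne : f i ≠ F (F (f i)) := fun h => htwo (by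
      rw [← e] at h
      exact left_eq_add.1 (hinj h))
    rw [e, hf]
    exact (hturn _ (hmem i)).not_collinear (hedge _ (hmem i)) (hedge _ (hF _ (hmem i))) hne

/-- The successor map of the polygon, shifted to the square grid. -/
def gridNext (w M : ℤ) (p : ℤ × ℤ) : ℤ × ℤ :=
  ((polyNext w M (p.1 - w, p.2)).1 + w, (polyNext w M (p.1 - w, p.2)).2)

theorem gridNext_semiconj (w M : ℤ) :
    Function.Semiconj (fun p : ℤ × ℤ => (p.1 + w, p.2)) (polyNext w M) (gridNext w M) := by
  intro p
  simp [gridNext]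

theorem exists_long_polygon {n : ℕ} {w M : ℤ} (hw : w = 2 ∨ w = 3) (hM : 3 ≤ M)
    (hn : (n : ℤ) = 2 * M + w) :
    ∃ f, IsSimpleClosedGridPolygon n f ∧ IsProper n f ∧ ∀ i, f (i + 1) = gridNext w M (f i) := by
  have hmem : ∀ p : ℤ × ℤ, p ∈ gridSet n ↔ InRange w M (p.1 - w, p.2) := by
    intro p
    simp only [gridSet, InRange, Set.mem_ofPred_eq, hn]
    omega
  have hmem' : ∀ p : ℤ × ℤ, InRange w M p → (p.1 + w, p.2) ∈ gridSet n := by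
    intro p hp
    rw [hmem]
    simpa using hp
  refine exists_proper_polygon (by omega) (g := fun y a => barrier w M y (a - w) + w)
    (p₀ := (1 + w, 1)) (fun y => monotone_int_of_le_succ fun a => ?_) ?_ (fun p hp => ?_)
    (fun p hp => ?_) ⟨(0 + w, 2), ?_, ?_⟩ (fun p hp => ?_) fun p hp => ?_
  · have h := barrier_mono (w := w) hM y (a - w)
    rw [show a - w + 1 = a + 1 - w by ring] at h
    linarith
  · exact hmem' (1, 1) ⟨by dsimp only; omega, by dsimp only; omega, le_rfl, by dsimp only; omega⟩
  · exact hmem' _ (polyNext_inRange hw hM ((hmem p).1 hp))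
  · obtain ⟨i, hi⟩ := reach_of_inRange hw hM ((hmem p).1 hp)
    refine ⟨i, ?_⟩
    have h := (gridNext_semiconj w M).iterate_right i (1, 1)
    rw [hi] at h
    simpa using h.symm
  · exact hmem' (0, 2) ⟨by dsimp only; omega, by dsimp only; omega, by norm_num,
      by dsimp only; omega⟩
  · have h := gridNext_semiconj w M (0, 2)
    rw [polyNext_last hM hw] at h
    exact h.symm
  · have h := polyNext_edge hw hM ((hmem p).1 hp)
    unfold IsEdge at h ⊢
    unfold gridNext
    dsimp only at h ⊢
    rw [show p.1 - w + 1 = p.1 + 1 - w by ring] at h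
    simp only [show ∀ a, a + w + 1 - w = a + 1 by intro a; ring, add_sub_cancel_right]
    omega
  · have h := polyNext_turn hw hM ((hmem p).1 hp)
    unfold IsTurn at h ⊢
    unfold gridNext
    dsimp only at h ⊢
    simp only [add_sub_cancel_right, Prod.mk.eta]
    omega

theorem polyWeight_eq_sum_gridSet {n : ℕ} (hn : n ≠ 0) {f : ZMod (n ^ 2) → ℤ × ℤ}
    {F : ℤ × ℤ → ℤ × ℤ} (hf : IsSimpleClosedGridPolygon n f) (hF : ∀ i, f (i + 1) = F (f i)) :
    polyWeight n f = ∑ p ∈ Finset.Icc (1 : ℤ) n ×ˢ Finset.Icc (1 : ℤ) n, sqLen p (F p) := by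
  have : NeZero (n ^ 2) := ⟨pow_ne_zero 2 hn⟩
  have himage : Finset.univ.image f = Finset.Icc (1 : ℤ) n ×ˢ Finset.Icc (1 : ℤ) n := by
    rw [← Finset.coe_inj, ← gridSet_eq_coe, ← hf.range_eq, Finset.coe_image, Finset.coe_univ,
      Set.image_univ]
  rw [← himage, Finset.sum_image hf.inj.injOn, polyWeight]
  simp only [hF]
  refine Finset.sum_bij (fun i _ => (i : ZMod (n ^ 2))) (fun _ _ => Finset.mem_univ _)
    (fun i hi j hj h => ?_) (fun b _ => ⟨b.val, ?_, ?_⟩) fun _ _ => rfl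
  · rw [Finset.mem_range] at hi hj
    rwa [ZMod.natCast_eq_natCast_iff', Nat.mod_eq_of_lt hi, Nat.mod_eq_of_lt hj] at h
  · exact Finset.mem_range.2 (ZMod.val_lt b)
  · exact ZMod.natCast_zmod_val b

theorem sqLen_le {n : ℕ} {p q : ℤ × ℤ} (hp : p ∈ gridSet n) (hq : q ∈ gridSet n) :
    sqLen p q ≤ 2 * n ^ 2 := by
  obtain ⟨h1, h2, h3, h4⟩ := hp
  obtain ⟨h1', h2', h3', h4'⟩ := hq
  have e1 : (q.1 - p.1).natAbs ≤ n := by omega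
  have e2 : (q.2 - p.2).natAbs ≤ n := by omega
  unfold sqLen
  have := Nat.pow_le_pow_left e1 2
  have := Nat.pow_le_pow_left e2 2
  omega

theorem polyWeight_le {n : ℕ} {f : ZMod (n ^ 2) → ℤ × ℤ} (hf : IsSimpleClosedGridPolygon n f) :
    polyWeight n f ≤ 2 * n ^ 4 := by
  have hmem : ∀ i, f i ∈ gridSet n := fun i => hf.range_eq ▸ Set.mem_range_self i
  calc polyWeight n f ≤ ∑ _i ∈ Finset.range (n ^ 2), 2 * n ^ 2 :=
        Finset.sum_le_sum fun i _ => sqLen_le (hmem _) (hmem _)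
    _ = 2 * n ^ 4 := by
        rw [Finset.sum_const, Finset.card_range, smul_eq_mul]
        ring

theorem polyWeight_le_polyA0 {n : ℕ} {f : ZMod (n ^ 2) → ℤ × ℤ}
    (hf : IsSimpleClosedGridPolygon n f) (hf' : IsProper n f) : polyWeight n f ≤ polyA0 n :=
  le_csSup ⟨2 * n ^ 4, by rintro _ ⟨f, hf, -, rfl⟩; exact polyWeight_le hf⟩ ⟨f, hf, hf', rfl⟩

theorem polyA0_le (n : ℕ) : polyA0 n ≤ 2 * n ^ 4 :=
  csSup_le' (by rintro _ ⟨f, hf, -, rfl⟩; exact polyWeight_le hf)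

theorem le_polyA0 {n m : ℕ} {w : ℤ} (hw : w = 2 ∨ w = 3) (hn : (n : ℤ) = 2 * (m + 3 : ℕ) + w) :
    (2 * m + 4) * (2 * m + 2) * (m + 1) ^ 2 ≤ polyA0 n := by
  obtain ⟨f, hf, hf', hF⟩ := exists_long_polygon hw (by omega) hn
  refine le_trans ?_ (polyWeight_le_polyA0 hf hf')
  rw [polyWeight_eq_sum_gridSet (by omega) hf hF]
  push_cast at hn
  have hsub : Finset.Icc (w + 2) (w + 2 * m + 5) ×ˢ Finset.Icc (3 : ℤ) (2 * m + 4) ⊆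
      Finset.Icc (1 : ℤ) n ×ˢ Finset.Icc (1 : ℤ) n :=
    Finset.product_subset_product (Finset.Icc_subset_Icc (by omega) (by omega))
      (Finset.Icc_subset_Icc (by omega) (by omega))
  refine le_trans ?_ (Finset.sum_le_sum_of_subset hsub)
  have hcard : (Finset.Icc (w + 2) (w + 2 * m + 5) ×ˢ Finset.Icc (3 : ℤ) (2 * m + 4)).card =
      (2 * m + 4) * (2 * m + 2) := by
    rw [Finset.card_product, Int.card_Icc, Int.card_Icc]
    congr 1 <;> omega
  rw [← hcard, ← smul_eq_mul]
  refine Finset.card_nsmul_le_sum _ _ _ fun p hp => ?_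
  rw [Finset.mem_product, Finset.mem_Icc, Finset.mem_Icc] at hp
  have h := polyNext_long (w := w) (M := (m + 3 : ℕ)) (x := p.1 - w) (y := p.2)
    (by omega) (by omega) (by omega) (by omega)
  unfold sqLen gridNext
  refine le_trans (Nat.pow_le_pow_left ?_ 2) (Nat.le_add_right _ _)
  dsimp only
  omega

theorem le_polyA0_of_le {n : ℕ} (hn : 9 ≤ n) :
    ((n : ℝ) - 7) ^ 4 / 4 ≤ polyA0 n := by
  have key : ∀ (m : ℕ) (w : ℤ), w = 2 ∨ w = 3 → (n : ℤ) = 2 * (m + 3 : ℕ) + w →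
      ((n : ℝ) - 7) ^ 4 / 4 ≤ polyA0 n := by
    intro m w hw hnw
    have h : (((2 * m + 4) * (2 * m + 2) * (m + 1) ^ 2 : ℕ) : ℝ) ≤ polyA0 n := by
      exact_mod_cast le_polyA0 hw hnw
    refine le_trans ?_ h
    have h1 : n ≤ 2 * m + 9 := by omega
    have h1' : (n : ℝ) ≤ 2 * m + 9 := by exact_mod_cast h1
    have h2 : (9 : ℝ) ≤ n := by exact_mod_cast hn
    have h3 : ((n : ℝ) - 7) ^ 4 ≤ (2 * m + 2) ^ 4 := pow_le_pow_left₀ (by linarith) (by linarith) 4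
    have h4 : (0 : ℝ) ≤ (2 * m + 2) * (m + 1) ^ 2 := by positivity
    push_cast
    nlinarith
  obtain h | h := Nat.even_or_odd' n |>.choose_spec
  · exact key (n / 2 - 4) 2 (Or.inl rfl) (by push_cast; omega)
  · exact key (n / 2 - 4) 3 (Or.inr rfl) (by push_cast; omega)

/-- `liminf_{n → ∞} a₀(n)/n⁴ ≥ 1/4`. -/
theorem liminf_polyA0_ge :
    (1 / 4 : ℝ) ≤ Filter.liminf (fun n : ℕ => (polyA0 n : ℝ) / (n : ℝ) ^ 4) Filter.atTop := by
  have hlim : Filter.Tendsto (fun n : ℕ => (1 - 7 * (n : ℝ)⁻¹) ^ 4 / 4) Filter.atTop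
      (nhds (1 / 4)) := by
    have h := (((tendsto_inv_atTop_nhds_zero_nat (𝕜 := ℝ)).const_mul 7).const_sub 1).pow 4
    simpa using h.div_const 4
  rw [← hlim.liminf_eq]
  refine Filter.liminf_le_liminf ?_ hlim.isBoundedUnder_ge ?_
  · filter_upwards [Filter.eventually_ge_atTop 9] with n hn
    have hpos : (0 : ℝ) < n := by exact_mod_cast (by omega : 0 < n)
    rw [le_div_iff₀ (by positivity)]
    refine le_trans (le_of_eq ?_) (le_polyA0_of_le hn)
    field_simp
  · refine Filter.IsBoundedUnder.isCoboundedUnder_ge ⟨2, Filter.eventually_map.2 ?_⟩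
    refine Filter.Eventually.of_forall fun n => div_le_of_le_mul₀ (by positivity) (by norm_num) ?_
    exact_mod_cast polyA0_le n
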